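/- arXiv:1911.09910 — 3 statements merged into one kernel-verified Lean document; each statement's English description precedes it below -/
import Mathlib

section
/- Let θ > 0, let n be a positive integer, let α ∈ (0,1), and let μ = Measure.pi (fun _ : Fin n => Unif(−θ, θ)). Define w̄(w) = max_{i ∈ Fin n} |w i|. Then μ({w : Fin n → ℝ | w̄(w) ≤ θ ∧ θ ≤ w̄(w) · α^{−1/n}}) = 1 − α. -/
open MeasureTheory

/-- `unif a b` is the uniform probability measure on the interval `[a, b]`:
`(b - a)⁻¹` times Lebesgue measure restricted to `[a, b]`. -/
noncomputable def unif (a b : ℝ) : Measure ℝ :=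
  (ENNReal.ofReal (b - a))⁻¹ • volume.restrict (Set.Icc a b)

theorem isProbabilityMeasure_unif {a b : ℝ} (hab : a < b) : IsProbabilityMeasure (unif a b) := by
  constructor
  rw [unif, Measure.smul_apply, Measure.restrict_apply_univ, Real.volume_Icc, smul_eq_mul]
  exact ENNReal.inv_mul_cancel (by simpa using hab) ENNReal.ofReal_ne_top

theorem unif_Icc_self {a b : ℝ} (hab : a < b) : unif a b (Set.Icc a b) = 1 := by
  rw [unif, Measure.smul_apply, Measure.restrict_apply_self, Real.volume_Icc, smul_eq_mul]
  exact ENNReal.inv_mul_cancel (by simpa using hab) ENNReal.ofReal_ne_top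

theorem unif_Ioo {a b c d : ℝ} (hab : a < b) (hac : a ≤ c) (hdb : d ≤ b) :
    unif a b (Set.Ioo c d) = ENNReal.ofReal ((d - c) / (b - a)) := by
  have hsub : Set.Ioo c d ⊆ Set.Icc a b :=
    Set.Ioo_subset_Icc_self.trans (Set.Icc_subset_Icc hac hdb)
  rw [unif, Measure.smul_apply, Measure.restrict_eq_self _ hsub, Real.volume_Ioo, smul_eq_mul,
    ENNReal.ofReal_div_of_pos (sub_pos.2 hab), ENNReal.div_eq_inv_mul]

/-- The maximum of the `|w i|` lies in `[c, θ]` iff `w` lies in the cube `[-θ, θ]^ι` but not in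
the open cube `(-c, c)^ι`. -/
theorem setOf_iSup_abs_mem_Icc {ι : Type*} [Finite ι] [Nonempty ι] (c θ : ℝ) :
    {w : ι → ℝ | (⨆ i, |w i|) ∈ Set.Icc c θ} =
      (Set.univ.pi fun _ => Set.Icc (-θ) θ) \ Set.univ.pi fun _ => Set.Ioo (-c) c := by
  ext w
  have hle : (⨆ i, |w i|) ≤ θ ↔ ∀ i, |w i| ≤ θ := ciSup_le_iff (Set.finite_range _).bddAbove
  have hlt : (⨆ i, |w i|) < c ↔ ∀ i, |w i| < c := by
    refine ⟨fun h i => (le_ciSup (Set.finite_range _).bddAbove i).trans_lt h, fun h => ?_⟩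
    obtain ⟨i, hi⟩ := exists_eq_ciSup_of_finite (f := fun i => |w i|)
    exact hi ▸ h i
  simp only [Set.mem_ofPred_eq, Set.mem_Icc, Set.mem_sdiff, Set.mem_univ_pi, Set.mem_Ioo,
    ← abs_le, ← abs_lt, ← hle, ← hlt, not_lt]
  exact and_comm

/-- **Exact coverage.** With `w̄ = max_i |w i|` over `n` i.i.d. `Unif(-θ, θ)` samples,
`[w̄, w̄ · α^{-1/n}]` is an exact `(1 - α)`-confidence interval for `θ`:
`P(w̄ ≤ θ ∧ θ ≤ w̄ · α^{-1/n}) = 1 - α`. -/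
theorem uniform_confidence_interval_coverage (θ : ℝ) (hθ : 0 < θ) (n : ℕ) (hn : 0 < n)
    (α : ℝ) (hα : α ∈ Set.Ioo (0 : ℝ) 1) :
    (Measure.pi fun _ : Fin n => unif (-θ) θ)
      {w : Fin n → ℝ |
        (⨆ i, |w i|) ≤ θ ∧ θ ≤ (⨆ i, |w i|) * α ^ (-1 / (n : ℝ))} =
      ENNReal.ofReal (1 - α) := by
  obtain ⟨hα0, hα1⟩ := hα
  have : Nonempty (Fin n) := ⟨⟨0, hn⟩⟩
  have hθθ : -θ < θ := by linarith
  have := isProbabilityMeasure_unif hθθ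
  set r : ℝ := α ^ ((n : ℝ)⁻¹) with hr
  have hr0 : 0 < r := Real.rpow_pos_of_pos hα0 _
  have hr1 : r ≤ 1 := Real.rpow_le_one hα0.le hα1.le (by positivity)
  have hrn : r ^ n = α := Real.rpow_inv_natCast_pow hα0.le hn.ne'
  have hinv : α ^ (-1 / (n : ℝ)) = r⁻¹ := by
    rw [hr, ← Real.rpow_neg hα0.le, neg_div, one_div]
  have hcθ : θ * r ≤ θ := mul_le_of_le_one_right hθ.le hr1
  have hset : {w : Fin n → ℝ | (⨆ i, |w i|) ≤ θ ∧ θ ≤ (⨆ i, |w i|) * α ^ (-1 / (n : ℝ))} =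
      {w : Fin n → ℝ | (⨆ i, |w i|) ∈ Set.Icc (θ * r) θ} := by
    ext w
    rw [Set.mem_ofPred_eq, Set.mem_ofPred_eq, Set.mem_Icc, hinv, le_mul_inv_iff₀ hr0, and_comm]
  have hratio : (θ * r - -(θ * r)) / (θ - -θ) = r := by
    field_simp
  rw [hset, setOf_iSup_abs_mem_Icc, measure_sdiff
    (Set.pi_mono fun _ _ => Set.Ioo_subset_Icc_self.trans (Set.Icc_subset_Icc (by linarith) hcθ))
    (MeasurableSet.univ_pi fun _ => measurableSet_Ioo).nullMeasurableSet (measure_ne_top _ _),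
    Measure.pi_pi, Measure.pi_pi, unif_Icc_self hθθ, unif_Ioo hθθ (by linarith) hcθ, hratio]
  simp only [Finset.prod_const, Finset.card_univ, Fintype.card_fin, one_pow]
  rw [← ENNReal.ofReal_pow hr0.le, hrn, ENNReal.ofReal_sub _ hα0.le, ENNReal.ofReal_one]
end

section
/- Let θ > 0, let n be a positive integer, let α ∈ (0,1), and let μ = Measure.pi (fun _ : Fin n => Unif(−θ, θ)). Define w̄(w) = max_{i ∈ Fin n} |w i|. Then the miscoverage probability is exactly α: μ({w : Fin n → ℝ | w̄(w) · α^{−1/n} < θ}) = α. -/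
open MeasureTheory

instance isFiniteMeasure_unif (a b : ℝ) : IsFiniteMeasure (unif a b) := by
  rcases le_or_gt b a with h | h
  · have h0 : volume.restrict (Set.Icc a b) = 0 := by
      rw [Measure.restrict_eq_zero, Real.volume_Icc, ENNReal.ofReal_eq_zero]
      linarith
    rw [unif, h0, smul_zero]
    infer_instance
  · exact Measure.smul_finite _ (ENNReal.inv_ne_top.2 (by simpa using h))

/-- The mass that `Unif(-θ, θ)` gives to a centred subinterval scaled by `c`. -/
theorem unif_Ioo_scaled {θ c : ℝ} (hθ : 0 < θ) (hc : c ≤ 1) :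
    unif (-θ) θ (Set.Ioo (-(θ * c)) (θ * c)) = ENNReal.ofReal c := by
  have hsub : Set.Ioo (-(θ * c)) (θ * c) ⊆ Set.Icc (-θ) θ := fun x hx =>
    ⟨by nlinarith [hx.1], by nlinarith [hx.2]⟩
  rw [unif, Measure.smul_apply, Measure.restrict_apply measurableSet_Ioo,
    Set.inter_eq_left.2 hsub, Real.volume_Ioo, smul_eq_mul,
    ← ENNReal.ofReal_inv_of_pos (by linarith), ← ENNReal.ofReal_mul (by simp; linarith)]
  congr 1
  field_simp

theorem ciSup_abs_lt_iff {ι : Type*} [Finite ι] [Nonempty ι] {w : ι → ℝ} {r : ℝ} :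
    (⨆ i, |w i|) < r ↔ ∀ i, w i ∈ Set.Ioo (-r) r := by
  simp_rw [Set.mem_Ioo, ← abs_lt]
  refine ⟨fun h i => (le_ciSup (Set.finite_range _).bddAbove i).trans_lt h, fun h => ?_⟩
  obtain ⟨i, hi⟩ := exists_eq_ciSup_of_finite (f := fun i => |w i|)
  exact hi ▸ h i

/-- **Exact miscoverage.** With `w̄ = max_i |w i|` over `n` i.i.d. `Unif(-θ, θ)` samples,
the probability that the confidence interval fails to cover `θ`, i.e. that
`w̄ · α^{-1/n} < θ`, is exactly `α`. -/
theorem uniform_confidence_interval_miscoverage (θ : ℝ) (hθ : 0 < θ) (n : ℕ) (hn : 0 < n)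
    (α : ℝ) (hα : α ∈ Set.Ioo (0 : ℝ) 1) :
    (Measure.pi fun _ : Fin n => unif (-θ) θ)
      {w : Fin n → ℝ | (⨆ i, |w i|) * α ^ (-1 / (n : ℝ)) < θ} =
      ENNReal.ofReal α := by
  have : Nonempty (Fin n) := ⟨⟨0, hn⟩⟩
  obtain ⟨hα0, hα1⟩ := hα
  set c : ℝ := α ^ (1 / (n : ℝ)) with hc
  have hc0 : 0 < c := Real.rpow_pos_of_pos hα0 _
  have hc1 : c ≤ 1 := Real.rpow_le_one hα0.le hα1.le (by positivity)
  have hcn : c ^ n = α := by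
    rw [hc, one_div, Real.rpow_inv_natCast_pow hα0.le hn.ne']
  have hinv : α ^ (-1 / (n : ℝ)) = c⁻¹ := by
    rw [hc, neg_div, Real.rpow_neg hα0.le]
  have hset : {w : Fin n → ℝ | (⨆ i, |w i|) * α ^ (-1 / (n : ℝ)) < θ} =
      Set.univ.pi fun _ => Set.Ioo (-(θ * c)) (θ * c) := by
    ext w
    rw [Set.mem_ofPred_eq, hinv, mul_inv_lt_iff₀ hc0, ciSup_abs_lt_iff, Set.mem_univ_pi]
  rw [hset, Measure.pi_pi]
  simp only [unif_Ioo_scaled hθ hc1, Finset.prod_const, Finset.card_univ, Fintype.card_fin]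
  rw [← ENNReal.ofReal_pow hc0.le, hcn]
end

section
/- Define the functions p₁, p₂ : ℝ → ℝ by p₁(z) = 0.4·1{|z| ≤ 1} + 0.1·1{1 < |z| ≤ 2} and p₂(z) = 0.4·1{|z| ≤ 1} + 0.01·1{1 < |z| ≤ 11}, and let P₁, P₂ be the measures on ℝ with densities p₁, p₂ with respect to Lebesgue measure. Then: (a) P₁ and P₂ are probability measures; (b) P₁ and P₂ agree on every Borel subset of [−1, 1]; (c) P₁({z : |z| > 1.5}) = 0.1; (d) P₂({z : |z| > 1.5}) = 0.19; and (e) P₂({z : |z| > 6}) = 0.1. -/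
open MeasureTheory

/-- The density `p₁(z) = 0.4·1{|z| ≤ 1} + 0.1·1{1 < |z| ≤ 2}`. -/
noncomputable def p₁ (z : ℝ) : ℝ :=
  0.4 * Set.indicator {z : ℝ | |z| ≤ 1} 1 z +
    0.1 * Set.indicator {z : ℝ | 1 < |z| ∧ |z| ≤ 2} 1 z

/-- The density `p₂(z) = 0.4·1{|z| ≤ 1} + 0.01·1{1 < |z| ≤ 11}`. -/
noncomputable def p₂ (z : ℝ) : ℝ :=
  0.4 * Set.indicator {z : ℝ | |z| ≤ 1} 1 z +
    0.01 * Set.indicator {z : ℝ | 1 < |z| ∧ |z| ≤ 11} 1 z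

/-- The measure `P₁` with density `p₁` with respect to Lebesgue measure. -/
noncomputable def P₁ : Measure ℝ :=
  volume.withDensity fun z => ENNReal.ofReal (p₁ z)

/-- The measure `P₂` with density `p₂` with respect to Lebesgue measure. -/
noncomputable def P₂ : Measure ℝ :=
  volume.withDensity fun z => ENNReal.ofReal (p₂ z)

/-- The set of reals with `r < |z| ≤ R` has Lebesgue measure `2 (R - r)`. -/
theorem volume_abs_mem_Ioc {r R : ℝ} (hr : 0 ≤ r) (hrR : r ≤ R) :
    volume {z : ℝ | r < |z| ∧ |z| ≤ R} = ENNReal.ofReal (2 * (R - r)) := by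
  have hset : {z : ℝ | r < |z| ∧ |z| ≤ R} = Set.Icc (-R) R \ Set.Icc (-r) r := by
    ext z
    simp only [Set.mem_ofPred_eq, Set.mem_sdiff, Set.mem_Icc, ← abs_le, not_le]
    exact and_comm
  rw [hset, measure_sdiff (Set.Icc_subset_Icc (neg_le_neg hrR) hrR)
    measurableSet_Icc.nullMeasurableSet (by simp), Real.volume_Icc, Real.volume_Icc,
    ← ENNReal.ofReal_sub _ (by linarith)]
  congr 1
  ring

/-- The set of reals with `|z| ≤ r` has Lebesgue measure `2 r`. -/
theorem volume_abs_le (r : ℝ) : volume {z : ℝ | |z| ≤ r} = ENNReal.ofReal (2 * r) := by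
  have hset : {z : ℝ | |z| ≤ r} = Set.Icc (-r) r := by
    ext z
    simp [abs_le]
  rw [hset, Real.volume_Icc]
  congr 1
  ring

/-- The measure with density `a·1_A + b·1_B` assigns `a |s ∩ A| + b |s ∩ B|` to `s`. -/
theorem withDensity_two_indicators {α : Type*} [MeasurableSpace α] (μ : Measure α)
    {a b : ℝ} (ha : 0 ≤ a) (hb : 0 ≤ b)
    {A B : Set α} (hA : MeasurableSet A) (hB : MeasurableSet B) {s : Set α}
    (hs : MeasurableSet s) :
    μ.withDensity (fun z => ENNReal.ofReal (a * A.indicator 1 z + b * B.indicator 1 z)) s =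
      ENNReal.ofReal a * μ (s ∩ A) + ENNReal.ofReal b * μ (s ∩ B) := by
  have hfun : (fun z => ENNReal.ofReal (a * A.indicator 1 z + b * B.indicator 1 z)) =
      A.indicator (fun _ => ENNReal.ofReal a) + B.indicator (fun _ => ENNReal.ofReal b) := by
    ext z
    by_cases hzA : z ∈ A <;> by_cases hzB : z ∈ B <;>
      simp [hzA, hzB, ENNReal.ofReal_add, ha, hb]
  rw [hfun, withDensity_add_left (measurable_const.indicator hA), Measure.add_apply,
    withDensity_indicator hA, withDensity_indicator hB, withDensity_const, withDensity_const,
    Measure.smul_apply, Measure.smul_apply, Measure.restrict_apply hs, Measure.restrict_apply hs,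
    smul_eq_mul, smul_eq_mul]

theorem measurableSet_abs_le (r : ℝ) : MeasurableSet {z : ℝ | |z| ≤ r} :=
  measurableSet_le (by fun_prop) measurable_const

theorem measurableSet_lt_abs (r : ℝ) : MeasurableSet {z : ℝ | r < |z|} :=
  measurableSet_lt measurable_const (by fun_prop)

theorem P₁_apply {s : Set ℝ} (hs : MeasurableSet s) :
    P₁ s = ENNReal.ofReal 0.4 * volume (s ∩ {z : ℝ | |z| ≤ 1}) +
      ENNReal.ofReal 0.1 * volume (s ∩ {z : ℝ | 1 < |z| ∧ |z| ≤ 2}) :=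
  withDensity_two_indicators volume (by norm_num) (by norm_num) (measurableSet_abs_le 1)
    ((measurableSet_lt_abs 1).inter (measurableSet_abs_le 2)) hs

theorem P₂_apply {s : Set ℝ} (hs : MeasurableSet s) :
    P₂ s = ENNReal.ofReal 0.4 * volume (s ∩ {z : ℝ | |z| ≤ 1}) +
      ENNReal.ofReal 0.01 * volume (s ∩ {z : ℝ | 1 < |z| ∧ |z| ≤ 11}) :=
  withDensity_two_indicators volume (by norm_num) (by norm_num) (measurableSet_abs_le 1)
    ((measurableSet_lt_abs 1).inter (measurableSet_abs_le 11)) hs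

theorem lt_abs_inter_abs_le_eq_empty {r t : ℝ} (h : t ≤ r) :
    {z : ℝ | r < |z|} ∩ {z : ℝ | |z| ≤ t} = ∅ := by
  ext z
  simp only [Set.mem_inter_iff, Set.mem_ofPred_eq, Set.mem_empty_iff_false, iff_false]
  rintro ⟨h₁, h₂⟩
  linarith

theorem lt_abs_inter_abs_mem_Ioc {r t R : ℝ} (h : t ≤ r) :
    {z : ℝ | r < |z|} ∩ {z : ℝ | t < |z| ∧ |z| ≤ R} = {z : ℝ | r < |z| ∧ |z| ≤ R} := by
  ext z
  simp only [Set.mem_inter_iff, Set.mem_ofPred_eq]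
  exact ⟨fun hz => ⟨hz.1, hz.2.2⟩, fun hz => ⟨hz.1, h.trans_lt hz.1, hz.2⟩⟩

theorem P₁_lt_abs {r : ℝ} (h₁ : 1 ≤ r) (h₂ : r ≤ 2) :
    P₁ {z : ℝ | r < |z|} = ENNReal.ofReal (0.1 * (2 * (2 - r))) := by
  rw [P₁_apply (measurableSet_lt_abs r), lt_abs_inter_abs_le_eq_empty h₁,
    lt_abs_inter_abs_mem_Ioc h₁, volume_abs_mem_Ioc (by linarith) h₂, measure_empty, mul_zero,
    zero_add, ← ENNReal.ofReal_mul (by norm_num)]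

theorem P₂_lt_abs {r : ℝ} (h₁ : 1 ≤ r) (h₂ : r ≤ 11) :
    P₂ {z : ℝ | r < |z|} = ENNReal.ofReal (0.01 * (2 * (11 - r))) := by
  rw [P₂_apply (measurableSet_lt_abs r), lt_abs_inter_abs_le_eq_empty h₁,
    lt_abs_inter_abs_mem_Ioc h₁, volume_abs_mem_Ioc (by linarith) h₂, measure_empty, mul_zero,
    zero_add, ← ENNReal.ofReal_mul (by norm_num)]

theorem isProbabilityMeasure_P₁ : IsProbabilityMeasure P₁ := by
  constructor
  rw [P₁_apply MeasurableSet.univ, Set.univ_inter, Set.univ_inter, volume_abs_le,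
    volume_abs_mem_Ioc (by norm_num) (by norm_num), ← ENNReal.ofReal_mul (by norm_num),
    ← ENNReal.ofReal_mul (by norm_num), ← ENNReal.ofReal_add (by norm_num) (by norm_num)]
  norm_num

theorem isProbabilityMeasure_P₂ : IsProbabilityMeasure P₂ := by
  constructor
  rw [P₂_apply MeasurableSet.univ, Set.univ_inter, Set.univ_inter, volume_abs_le,
    volume_abs_mem_Ioc (by norm_num) (by norm_num), ← ENNReal.ofReal_mul (by norm_num),
    ← ENNReal.ofReal_mul (by norm_num), ← ENNReal.ofReal_add (by norm_num) (by norm_num)]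
  norm_num

theorem inter_abs_mem_Ioc_eq_empty {s : Set ℝ} {r : ℝ} (hs : s ⊆ Set.Icc (-r) r) (R : ℝ) :
    s ∩ {z : ℝ | r < |z| ∧ |z| ≤ R} = ∅ := by
  ext z
  simp only [Set.mem_inter_iff, Set.mem_ofPred_eq, Set.mem_empty_iff_false, iff_false]
  exact fun hz => absurd (abs_le.2 (hs hz.1)) (not_le.2 hz.2.1)

/-- **The paper's counterexample.** `P₁` and `P₂` are probability measures agreeing on all
Borel subsets of the observed convex hull `[-1, 1]`, yet `P₁(|z| > 1.5) = 0.1` while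
`P₂(|z| > 1.5) = 0.19`, and one must go out to `P₂(|z| > 6) = 0.1`: no scaling of the
convex hull can guarantee a prescribed failure probability without distributional
assumptions. -/
theorem convex_hull_counterexample :
    IsProbabilityMeasure P₁ ∧
    IsProbabilityMeasure P₂ ∧
    (∀ s : Set ℝ, MeasurableSet s → s ⊆ Set.Icc (-1 : ℝ) 1 → P₁ s = P₂ s) ∧
    P₁ {z : ℝ | 1.5 < |z|} = ENNReal.ofReal 0.1 ∧
    P₂ {z : ℝ | 1.5 < |z|} = ENNReal.ofReal 0.19 ∧
    P₂ {z : ℝ | 6 < |z|} = ENNReal.ofReal 0.1 := by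
  refine ⟨isProbabilityMeasure_P₁, isProbabilityMeasure_P₂, fun s hs hsub => ?_, ?_, ?_, ?_⟩
  · rw [P₁_apply hs, P₂_apply hs, inter_abs_mem_Ioc_eq_empty hsub,
      inter_abs_mem_Ioc_eq_empty hsub, measure_empty, mul_zero, mul_zero]
  · rw [P₁_lt_abs (by norm_num) (by norm_num)]
    norm_num
  · rw [P₂_lt_abs (by norm_num) (by norm_num)]
    norm_num
  · rw [P₂_lt_abs (by norm_num) (by norm_num)]
    norm_num
end
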